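/- Let d ≥ 2 and k ≥ 0 be integers. The set of points of ℤ^d in the interior of the Zaks–Perles–Wills simplex S_{d,k} is exactly {(1,1,…,1,j) : j = 1,…,k}; in particular, S_{d,k} has exactly k interior lattice points. -/

import Mathlib

open MeasureTheory ENNReal

noncomputable section

/-- Auxiliary recursion for the Sylvester sequence: `s_{i+1} = s_i (s_i - 1) + 1`,
which is equivalent to `s_i = 1 + s_1 ⋯ s_{i-1}` with `s_1 = 2`. -/
def sylAux : ℕ → ℕ
  | 0 => 2
  | n + 1 => sylAux n * (sylAux n - 1) + 1

/-- The Sylvester sequence `s_1 = 2`, `s_i = 1 + s_1 s_2 ⋯ s_{i-1}` (1-indexed). -/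
def syl (n : ℕ) : ℕ := sylAux (n - 1)

/-- The standard basis vector `e_i` of `ℝ^d`. -/
def stdBasis (d : ℕ) (i : Fin d) : Fin d → ℝ := Pi.single i 1

/-- The integer lattice `ℤ^d`, viewed as a subset of `ℝ^d`. -/
def latticePts (d : ℕ) : Set (Fin d → ℝ) :=
  Set.range fun z : Fin d → ℤ => fun i => (z i : ℝ)

/-- The Zaks–Perles–Wills simplex
`S_{d,k} = conv(0, s_1 e_1, …, s_{d-1} e_{d-1}, (k+1)(s_d - 1) e_d)`. -/
def ZPW (d k : ℕ) : Set (Fin d → ℝ) :=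
  convexHull ℝ (insert 0 (Set.range fun i : Fin d =>
    (if i.1 = d - 1 then ((k : ℝ) + 1) * ((syl d : ℝ) - 1) else (syl (i.1 + 1) : ℝ)) •
      stdBasis d i))

theorem zpwMemHull {d : ℕ} (a : Fin d → ℝ) (ha : ∀ i, 0 < a i) (x : Fin d → ℝ) :
    x ∈ convexHull ℝ (insert 0 (Set.range fun i : Fin d => a i • stdBasis d i)) ↔
      (∀ i, 0 ≤ x i) ∧ ∑ i, x i / a i ≤ 1 := by
  constructor
  · intro hx
    have hsub : convexHull ℝ (insert 0 (Set.range fun i : Fin d => a i • stdBasis d i)) ⊆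
        {x : Fin d → ℝ | (∀ i, 0 ≤ x i) ∧ ∑ i, x i / a i ≤ 1} := by
      apply convexHull_min
      · intro y hy
        rcases hy with rfl | ⟨j, rfl⟩
        · simp
        · constructor
          · intro i
            have := (ha j).le
            by_cases h : i = j
            · subst h; simp [stdBasis, this]
            · simp [stdBasis, Pi.single_apply, h]
          · have : ∀ i, (a j • stdBasis d j) i / a i = if i = j then 1 else 0 := by
              intro i
              by_cases h : i = j
              · subst h; simp [stdBasis, (ha i).ne']
              · simp [stdBasis, Pi.single_apply, h]
            simp only [this]
            simp
      · intro y hy z hz s t hs ht hst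
        refine ⟨fun i => ?_, ?_⟩
        · have h1 := mul_nonneg hs (hy.1 i)
          have h2 := mul_nonneg ht (hz.1 i)
          simpa using add_nonneg h1 h2
        · have : ∑ i, (s • y + t • z) i / a i = s * ∑ i, y i / a i + t * ∑ i, z i / a i := by
            rw [Finset.mul_sum, Finset.mul_sum, ← Finset.sum_add_distrib]
            refine Finset.sum_congr rfl fun i _ => ?_
            simp only [Pi.add_apply, Pi.smul_apply, smul_eq_mul]
            ring
          rw [this]
          have h1 := mul_le_mul_of_nonneg_left hy.2 hs
          have h2 := mul_le_mul_of_nonneg_left hz.2 ht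
          linarith
    exact hsub hx
  · rintro ⟨h0, h1⟩
    have key := (convex_convexHull ℝ
      (insert 0 (Set.range fun i : Fin d => a i • stdBasis d i))).sum_mem
      (t := (Finset.univ : Finset (Option (Fin d))))
      (w := fun o => o.elim (1 - ∑ i, x i / a i) (fun i => x i / a i))
      (z := fun o => o.elim 0 (fun i => a i • stdBasis d i)) ?_ ?_ ?_
    · convert key using 1
      rw [Fintype.sum_option]
      ext j
      simp only [Option.elim, smul_zero, zero_add, Finset.sum_apply, Pi.smul_apply, smul_eq_mul,
        stdBasis, Pi.single_apply]
      simp [(ha j).ne']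
    · rintro (_ | i) _
      · simpa using h1
      · exact div_nonneg (h0 i) (ha i).le
    · rw [Fintype.sum_option]; simp
    · rintro (_ | i) _
      · exact subset_convexHull ℝ _ (Set.mem_insert _ _)
      · exact subset_convexHull ℝ _ (Set.mem_insert_of_mem _ ⟨i, rfl⟩)

theorem zpwMemInterior {d : ℕ} (hd : 0 < d) (a : Fin d → ℝ) (ha : ∀ i, 0 < a i)
    (x : Fin d → ℝ) :
    x ∈ interior (convexHull ℝ (insert 0 (Set.range fun i : Fin d => a i • stdBasis d i))) ↔
      (∀ i, 0 < x i) ∧ ∑ i, x i / a i < 1 := by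
  constructor
  · intro hx
    have pert : ∀ c : ℝ, ∃ t : ℝ, 0 < t ∧ (fun i => x i + t * c) ∈
        convexHull ℝ (insert 0 (Set.range fun i : Fin d => a i • stdBasis d i)) := by
      intro c
      have hc : Continuous fun t : ℝ => (fun i => x i + t * c : Fin d → ℝ) := by fun_prop
      have h0 : interior (convexHull ℝ
          (insert 0 (Set.range fun i : Fin d => a i • stdBasis d i))) ∈
          nhds ((fun t : ℝ => (fun i => x i + t * c : Fin d → ℝ)) 0) := by
        simp only [zero_mul, add_zero]
        exact isOpen_interior.mem_nhds hx
      have h1 := hc.continuousAt.eventually h0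
      obtain ⟨e, he, hb⟩ := Metric.eventually_nhds_iff.1 h1
      refine ⟨e / 2, by positivity, interior_subset (hb ?_)⟩
      rw [Real.dist_eq, sub_zero, abs_of_pos (by positivity)]
      linarith
    constructor
    · intro i
      obtain ⟨t, ht, h⟩ := pert (-1)
      have := ((zpwMemHull a ha _).1 h).1 i
      linarith
    · obtain ⟨t, ht, h⟩ := pert 1
      refine lt_of_lt_of_le ?_ ((zpwMemHull a ha _).1 h).2
      haveI : Nonempty (Fin d) := ⟨⟨0, hd⟩⟩
      refine Finset.sum_lt_sum_of_nonempty Finset.univ_nonempty fun i _ => ?_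
      exact div_lt_div_of_pos_right (by linarith) (ha i)
  · rintro ⟨h0, h1⟩
    have hop : IsOpen {y : Fin d → ℝ | (∀ i, 0 < y i) ∧ ∑ i, y i / a i < 1} := by
      refine IsOpen.and ?_ ?_
      · simp only [Set.setOf_forall]
        exact isOpen_iInter_of_finite fun i => isOpen_lt continuous_const (continuous_apply i)
      · exact isOpen_lt (by fun_prop) continuous_const
    refine interior_maximal ?_ hop ⟨h0, h1⟩
    rintro y ⟨hy0, hy1⟩
    exact (zpwMemHull a ha y).2 ⟨fun i => (hy0 i).le, hy1.le⟩

theorem sylAux_two_le (n : ℕ) : 2 ≤ sylAux n := by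
  induction n with
  | zero => simp [sylAux]
  | succ n ih =>
    have : 1 ≤ sylAux n - 1 := by omega
    simp only [sylAux]
    nlinarith

theorem sylAux_succ_real (n : ℕ) :
    (sylAux (n + 1) : ℝ) = sylAux n * ((sylAux n : ℝ) - 1) + 1 := by
  have := sylAux_two_le n
  simp only [sylAux]
  push_cast [Nat.cast_sub (show 1 ≤ sylAux n by omega)]
  ring

theorem sylAux_lt {i n : ℕ} (h : i < n) : sylAux i < sylAux n := by
  refine strictMono_nat_of_lt_succ (fun m => ?_) h
  have h2 := sylAux_two_le m
  have : 1 ≤ sylAux m - 1 := by omega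
  simp only [sylAux]
  nlinarith

theorem sylAux_sum (n : ℕ) :
    ∑ i : Fin n, 1 / (sylAux i : ℝ) = 1 - 1 / ((sylAux n : ℝ) - 1) := by
  induction n with
  | zero => norm_num [sylAux]
  | succ n ih =>
    have h2 : (2 : ℝ) ≤ sylAux n := by exact_mod_cast sylAux_two_le n
    rw [Fin.sum_univ_castSucc]
    simp only [Fin.val_castSucc, Fin.val_last]
    rw [ih, sylAux_succ_real]
    have h3 : (sylAux n : ℝ) ≠ 0 := by linarith
    have h4 : (sylAux n : ℝ) - 1 ≠ 0 := by linarith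
    rw [add_sub_cancel_right]
    field_simp
    ring

theorem zpwInteriorIff (n k : ℕ) (x : Fin (n + 1) → ℝ) :
    x ∈ interior (ZPW (n + 1) k) ↔ (∀ i, 0 < x i) ∧
      ∑ i : Fin n, x i.castSucc / (sylAux i : ℝ) +
        x (Fin.last n) / (((k : ℝ) + 1) * ((sylAux n : ℝ) - 1)) < 1 := by
  have h2 : ∀ m, (2 : ℝ) ≤ sylAux m := fun m => by exact_mod_cast sylAux_two_le m
  unfold ZPW
  rw [zpwMemInterior (Nat.succ_pos n) (fun i : Fin (n + 1) =>
    (if i.1 = n + 1 - 1 then ((k : ℝ) + 1) * ((syl (n + 1) : ℝ) - 1) else (syl (i.1 + 1) : ℝ)))]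
  · rw [Fin.sum_univ_castSucc]
    have : ∀ i : Fin n, i.1 ≠ n := fun i => i.2.ne
    simp [syl, this]
  · intro i
    have := h2 i
    have := h2 n
    simp only [syl, Nat.add_sub_cancel]
    split_ifs
    · exact mul_pos (by positivity) (by linarith)
    · linarith

theorem zpwSet (n k : ℕ) :
    latticePts (n + 1) ∩ interior (ZPW (n + 1) k) =
      {p : Fin (n + 1) → ℝ | ∃ j : ℕ, 1 ≤ j ∧ j ≤ k ∧
        p = fun i => if i.1 = n + 1 - 1 then (j : ℝ) else 1} := by
  have h2 : ∀ m, (2 : ℝ) ≤ sylAux m := fun m => by exact_mod_cast sylAux_two_le m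
  have hn := h2 n
  have hN : (0 : ℝ) < (sylAux n : ℝ) - 1 := by linarith
  have hk : (0 : ℝ) < (k : ℝ) + 1 := by positivity
  have hmul : ∀ j : ℝ, 1 - 1 / ((sylAux n : ℝ) - 1) + j / (((k : ℝ) + 1) * ((sylAux n : ℝ) - 1)) < 1
      ↔ j < k + 1 := by
    intro j
    rw [← div_div, ← sub_pos]
    have : 1 - (1 - 1 / ((sylAux n : ℝ) - 1) + j / ((k : ℝ) + 1) / ((sylAux n : ℝ) - 1)) =
      (1 - j / ((k : ℝ) + 1)) / ((sylAux n : ℝ) - 1) := by ring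
    rw [this, div_pos_iff_of_pos_right hN, sub_pos, div_lt_one hk]
  ext p
  simp only [Set.mem_inter_iff, Set.mem_setOf_eq, zpwInteriorIff]
  constructor
  · rintro ⟨⟨z, rfl⟩, hpos, hlt⟩
    have hz : ∀ i, 1 ≤ z i := fun i => by
      have : (0 : ℝ) < z i := hpos i
      have : 0 < z i := by exact_mod_cast this
      omega
    have hz' : ∀ i, (1 : ℝ) ≤ z i := fun i => by exact_mod_cast hz i
    have hone : ∀ i : Fin n, z i.castSucc = 1 := by
      intro i
      by_contra hne
      have h22 : (2 : ℝ) ≤ z i.castSucc := by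
        have := hz i.castSucc
        have : 2 ≤ z i.castSucc := by omega
        exact_mod_cast this
      have hs : ∑ j : Fin n, (1 / (sylAux j : ℝ) + if j = i then 1 / (sylAux i : ℝ) else 0) ≤
          ∑ j : Fin n, (z j.castSucc : ℝ) / (sylAux j : ℝ) := by
        refine Finset.sum_le_sum fun j _ => ?_
        have hj : (0 : ℝ) < sylAux j := by linarith [h2 j]
        split_ifs with h
        · subst h
          rw [← add_div]
          exact div_le_div_of_nonneg_right (by linarith) hj.le
        · rw [add_zero]
          exact div_le_div_of_nonneg_right (hz' _) hj.le
      rw [Finset.sum_add_distrib, sylAux_sum] at hs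
      simp only [Finset.sum_ite_eq', Finset.mem_univ, if_true] at hs
      have hi : (sylAux i : ℝ) ≤ (sylAux n : ℝ) - 1 := by
        have : sylAux i + 1 ≤ sylAux n := sylAux_lt i.2
        have : (sylAux i : ℝ) + 1 ≤ (sylAux n : ℝ) := by exact_mod_cast this
        linarith
      have hinv := one_div_le_one_div_of_le (by linarith [h2 i]) hi
      have hlast : 0 < (z (Fin.last n) : ℝ) / (((k : ℝ) + 1) * ((sylAux n : ℝ) - 1)) :=
        div_pos (hpos _) (mul_pos hk hN)
      linarith
    simp only [hone, Int.cast_one] at hlt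
    rw [sylAux_sum, hmul] at hlt
    have hlt' : z (Fin.last n) < k + 1 := by exact_mod_cast hlt
    have hl := hz (Fin.last n)
    refine ⟨(z (Fin.last n)).toNat, by omega, by omega, ?_⟩
    have hcast : (((z (Fin.last n)).toNat : ℕ) : ℝ) = (z (Fin.last n) : ℝ) := by
      have : (((z (Fin.last n)).toNat : ℕ) : ℤ) = z (Fin.last n) := Int.toNat_of_nonneg (by omega)
      exact_mod_cast this
    funext i
    rw [hcast]
    refine Fin.lastCases ?_ (fun i => ?_) i
    · simp
    · have : i.1 ≠ n := i.2.ne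
      simp [this, hone]
  · rintro ⟨j, hj1, hjk, rfl⟩
    refine ⟨⟨fun i => if i.1 = n + 1 - 1 then (j : ℤ) else 1, ?_⟩, ?_, ?_⟩
    · funext i
      simp only
      split_ifs <;> simp
    · intro i
      simp only
      split_ifs
      · exact_mod_cast hj1
      · exact one_pos
    · have : ∀ i : Fin n, i.1 ≠ n := fun i => i.2.ne
      simp only [Nat.add_sub_cancel, Fin.val_castSucc, Fin.val_last, this, if_true, if_false]
      rw [sylAux_sum, hmul]
      exact_mod_cast Nat.lt_succ_of_le hjk

/-- For `d ≥ 2` and `k ≥ 0`, the interior lattice points of the Zaks–Perles–Wills simplex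
`S_{d,k}` are exactly the points `(1,…,1,j)` for `j = 1,…,k`; in particular `S_{d,k}` has
exactly `k` interior lattice points. -/
theorem interior_lattice_points_of_ZPW (d k : ℕ) (hd : 2 ≤ d) :
    latticePts d ∩ interior (ZPW d k) =
      {p : Fin d → ℝ | ∃ j : ℕ, 1 ≤ j ∧ j ≤ k ∧
        p = fun i => if i.1 = d - 1 then (j : ℝ) else 1} ∧
    (latticePts d ∩ interior (ZPW d k)).ncard = k := by
  obtain ⟨n, rfl⟩ : ∃ n, d = n + 1 := ⟨d - 1, by omega⟩
  refine ⟨zpwSet n k, ?_⟩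
  rw [zpwSet n k]
  have himg : {p : Fin (n + 1) → ℝ | ∃ j : ℕ, 1 ≤ j ∧ j ≤ k ∧
        p = fun i => if i.1 = n + 1 - 1 then (j : ℝ) else 1} =
      (fun (j : ℕ) (i : Fin (n + 1)) => if i.1 = n + 1 - 1 then (j : ℝ) else 1) ''
        (Finset.Icc 1 k : Finset ℕ) := by
    ext p
    simp only [Set.mem_setOf_eq, Set.mem_image, Finset.coe_Icc, Set.mem_Icc]
    constructor
    · rintro ⟨j, h1, h2, rfl⟩
      exact ⟨j, ⟨h1, h2⟩, rfl⟩
    · rintro ⟨j, ⟨h1, h2⟩, rfl⟩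
      exact ⟨j, h1, h2, rfl⟩
  rw [himg, Set.ncard_image_of_injective, Set.ncard_coe_finset]
  · simp
  · intro a b hab
    have := congrFun hab (Fin.last n)
    simpa using this
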